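/- Let U > 0 and let N be a positive integer. If k_1,…,k_N ∈ ℝ and x ∈ ℝ satisfy Σ_{j=1}^N θ_U(2·sin k_j − 2x) < (N−1)π, then x < (U/4)·tan(π/2 − π/(2N)) + 1. -/

import Mathlib

open Real

/-- The phase function `θ_U(x) = -2 arctan(2x/U)` of the Lieb–Wu equations. -/
noncomputable def theta (U x : ℝ) : ℝ := -2 * Real.arctan (2 * x / U)

theorem theta_antitone {U : ℝ} (hU : 0 < U) : Antitone (theta U) := by
  intro a b hab
  have : arctan (2 * a / U) ≤ arctan (2 * b / U) :=
    arctan_strictMono.monotone (by gcongr)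
  unfold theta
  linarith

theorem theta_neg (U x : ℝ) : theta U (-x) = 2 * arctan (2 * x / U) := by
  simp [theta, neg_div, arctan_neg]

/-- A priori bound on the auxiliary parameters: if
`Σ_j θ_U(2 sin k_j - 2x) < (N-1)π` then `x < (U/4)·tan(π/2 - π/(2N)) + 1`. -/
theorem lambda_upper_bound
    (U : ℝ) (hU : 0 < U) (N : ℕ) (hN : 0 < N) (k : Fin N → ℝ) (x : ℝ)
    (h : ∑ j : Fin N, theta U (2 * Real.sin (k j) - 2 * x) < ((N : ℝ) - 1) * π) :
    x < U / 4 * Real.tan (π / 2 - π / (2 * N)) + 1 := by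
  have hN1 : (1 : ℝ) ≤ N := by exact_mod_cast hN
  have hsum : (N : ℝ) * theta U (-(2 * (x - 1))) ≤
      ∑ j : Fin N, theta U (2 * Real.sin (k j) - 2 * x) := by
    have := Finset.card_nsmul_le_sum Finset.univ
      (fun j => theta U (2 * Real.sin (k j) - 2 * x)) (theta U (-(2 * (x - 1))))
      fun j _ => theta_antitone hU (by linarith [sin_le_one (k j)])
    simpa using this
  rw [theta_neg] at hsum
  set φ := π / 2 - π / (2 * N) with hφ
  have hNφ : (N : ℝ) * (2 * φ) = (N - 1) * π := by
    rw [hφ]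
    field_simp
  have hφ_lt : φ < π / 2 := by
    have : 0 < π / (2 * N) := by positivity
    linarith
  have hφ_nonneg : 0 ≤ φ := by
    have : π / (2 * N) ≤ π / 2 := by gcongr; linarith
    linarith
  have harctan : arctan (2 * (2 * (x - 1)) / U) < arctan (tan φ) := by
    rw [arctan_tan (by linarith [pi_pos]) hφ_lt]
    have := lt_of_mul_lt_mul_left ((hsum.trans_lt h).trans_eq hNφ.symm) (by positivity)
    linarith
  have htan := (div_lt_iff₀ hU).1 (arctan_strictMono.lt_iff_lt.1 harctan)
  linarith
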